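/- arXiv:2501.13738 — 2 statements merged into one kernel-verified Lean document; each statement's English description precedes it below -/
import Mathlib

section
/- Let c₀ ∈ ℂ and q₀ ≥ 1 be such that g_{q₀}(c₀) = 0 and g_j(c₀) ≠ 0 for all 1 ≤ j < q₀ (i.e. q₀ is the smallest positive integer with Q_{c₀}^{∘q₀}(0) = 0). Then the derivative satisfies g_{q₀}′(c₀) ≠ 0; equivalently, c₀ is a simple root of the polynomial g_{q₀}. -/
noncomputable section

/-- The critical-orbit functions of the quadratic family: `g_0 = 0`, `g_{n+1} = g_n² + c`,
so that `g_n(c) = Q_c^{∘n}(0)` where `Q_c(z) = z² + c`. -/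
def gfun : ℕ → ℂ → ℂ
  | 0, _ => 0
  | n + 1, c => (gfun n c) ^ 2 + c

open Polynomial in
/-- The critical-orbit polynomials `g_n`, with integer coefficients. -/
def gpoly : ℕ → ℤ[X]
  | 0 => 0
  | n + 1 => gpoly n ^ 2 + X

theorem aeval_gpoly (n : ℕ) (c : ℂ) : Polynomial.aeval c (gpoly n) = gfun n c := by
  induction n with
  | zero => simp [gpoly, gfun]
  | succ n ih => simp [gpoly, gfun, ih]

theorem gpoly_succ_monic_natDegree (n : ℕ) :
    (gpoly (n + 1)).Monic ∧ (gpoly (n + 1)).natDegree = 2 ^ n := by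
  induction n with
  | zero => simp [gpoly, Polynomial.monic_X]
  | succ n ih =>
    obtain ⟨hm, hd⟩ := ih
    have hsq : (gpoly (n + 1) ^ 2).natDegree = 2 ^ (n + 1) := by
      rw [hm.natDegree_pow, hd, pow_succ']
    have hlt : (Polynomial.X : Polynomial ℤ).natDegree < (gpoly (n + 1) ^ 2).natDegree := by
      rw [hsq, Polynomial.natDegree_X]
      exact Nat.one_lt_two_pow n.succ_ne_zero
    rw [gpoly]
    exact ⟨(hm.pow 2).add_of_left (Polynomial.degree_lt_degree hlt),
      (Polynomial.natDegree_add_eq_left_of_natDegree_lt hlt).trans hsq⟩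

theorem isIntegral_of_gfun_succ_eq_zero {n : ℕ} {c : ℂ} (h : gfun (n + 1) c = 0) :
    IsIntegral ℤ c :=
  ⟨gpoly (n + 1), (gpoly_succ_monic_natDegree n).1, (aeval_gpoly (n + 1) c).trans h⟩

theorem isIntegral_gfun {c : ℂ} (hc : IsIntegral ℤ c) (n : ℕ) : IsIntegral ℤ (gfun n c) := by
  induction n with
  | zero => exact isIntegral_zero
  | succ n ih => exact (ih.pow 2).add hc

theorem hasDerivAt_gfun_succ {n : ℕ} {c d : ℂ} (h : HasDerivAt (gfun n) d c) :
    HasDerivAt (gfun (n + 1)) (2 * (gfun n c * d) + 1) c := by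
  have h2 := (h.pow 2).add (hasDerivAt_id c)
  refine h2.congr_deriv ?_
  push_cast
  ring

theorem exists_isIntegral_hasDerivAt_gfun {c : ℂ} (hc : IsIntegral ℤ c) (n : ℕ) :
    ∃ d, IsIntegral ℤ d ∧ HasDerivAt (gfun n) d c := by
  induction n with
  | zero => exact ⟨0, isIntegral_zero, hasDerivAt_const c 0⟩
  | succ n ih =>
    obtain ⟨d, hd, h⟩ := ih
    refine ⟨_, ?_, hasDerivAt_gfun_succ h⟩
    have hp := (isIntegral_gfun hc n).mul hd
    rw [two_mul]
    exact (hp.add hp).add isIntegral_one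

theorem two_mul_add_one_ne_zero_of_isIntegral {z : ℂ} (hz : IsIntegral ℤ z) :
    2 * z + 1 ≠ 0 := by
  intro h
  have hz' : z = algebraMap ℚ ℂ (-1 / 2) := by
    push_cast [eq_ratCast]
    linear_combination h / 2
  rw [hz', isIntegral_algebraMap_iff (algebraMap ℚ ℂ).injective,
    IsIntegrallyClosed.isIntegral_iff] at hz
  obtain ⟨k, hk⟩ := hz
  have hk' : 2 * k = -1 := by
    have : (2 : ℚ) * k = -1 := by
      rw [← eq_intCast (algebraMap ℤ ℚ) k, hk]
      norm_num
    exact_mod_cast this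
  omega

theorem stmt2 (c₀ : ℂ) (q₀ : ℕ) (hq₀ : 1 ≤ q₀) (h0 : gfun q₀ c₀ = 0)
    (h1 : ∀ j, 1 ≤ j → j < q₀ → gfun j c₀ ≠ 0) :
    deriv (gfun q₀) c₀ ≠ 0 := by
  obtain ⟨n, rfl⟩ := Nat.exists_eq_add_of_le' hq₀
  have hc := isIntegral_of_gfun_succ_eq_zero h0
  obtain ⟨d, hd, h⟩ := exists_isIntegral_hasDerivAt_gfun hc n
  rw [(hasDerivAt_gfun_succ h).deriv]
  exact two_mul_add_one_ne_zero_of_isIntegral ((isIntegral_gfun hc n).mul hd)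
end
end

section
/- Let v₀ ∈ ℂ and define the critical orbit r_0 := 0, r_{ℓ+1} := R_{v₀}(r_ℓ) (defined as long as r_ℓ ≠ −1). Suppose ℓ₀ ≥ 1 is such that r_ℓ ∉ {0, −1} for all 1 ≤ ℓ < ℓ₀ and r_{ℓ₀} ∈ {0, −1} (i.e. ℓ₀ is the smallest positive integer with R_{v₀}^{∘ℓ₀}(0) equal to 0 or −1). Then the functions w_ℓ : ℂ → ℂ defined by w_0(v) := 0 and w_{ℓ+1}(v) := v + w_ℓ(v)²/(w_ℓ(v) + 1) are holomorphic in a neighborhood of v₀ for all ℓ ≤ ℓ₀, and the complex derivative satisfies w_{ℓ₀}′(v₀) ≠ 0. -/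
noncomputable section

/-- The critical orbit of the parabolic family `R_v(z) = v + z²/(z+1)`:
`w_0(v) = 0`, `w_{ℓ+1}(v) = v + w_ℓ(v)²/(w_ℓ(v)+1)`. -/
def wfun : ℕ → ℂ → ℂ
  | 0, _ => 0
  | n + 1, v => v + (wfun n v) ^ 2 / (wfun n v + 1)

open MeasureTheory Filter Topology Set Metric
open scoped ENNReal

/-- The map `y ↦ y + 1/y + a`, conjugate to `R_{a+1}` by the translation `z ↦ z + 1`. -/
def joukMap (a y : ℂ) : ℂ := y + y⁻¹ + a

theorem hasDerivAt_joukMap (a : ℂ) {y : ℂ} (hy : y ≠ 0) :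
    HasDerivAt (joukMap a) (1 - (y ^ 2)⁻¹) y := by
  rw [sub_eq_add_neg]
  exact ((hasDerivAt_id y).add (hasDerivAt_inv hy)).add_const a

theorem joukMap_sub {a y c : ℂ} (hy : y ≠ 0) (hc : c ≠ 0) :
    joukMap a y - joukMap a c = (y - c) * (y * c - 1) / (y * c) := by
  simp only [joukMap]
  field_simp
  ring

/-- Change of variables under an injective holomorphic map. -/
theorem lintegral_image_eq_lintegral_enorm_deriv_sq_mul {f f' : ℂ → ℂ} {s : Set ℂ}
    (hs : MeasurableSet s) (hf : ∀ x ∈ s, HasDerivAt f (f' x) x) (hinj : InjOn f s)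
    (g : ℂ → ℝ≥0∞) :
    ∫⁻ x in f '' s, g x = ∫⁻ x in s, ‖f' x‖ₑ ^ 2 * g (f x) := by
  rw [lintegral_image_eq_lintegral_abs_det_fderiv_mul volume hs
    (fun x hx => ((hf x hx).hasFDerivAt.restrictScalars ℝ).hasFDerivWithinAt) hinj]
  refine lintegral_congr fun x => ?_
  congr 1
  simp [ContinuousLinearMap.det, LinearMap.det_restrictScalars,
    Algebra.norm_complex_eq, Complex.normSq_eq_norm_sq, ENNReal.ofReal_pow]

theorem injOn_joukMap (a : ℂ) : InjOn (joukMap a) {y | 1 < ‖y‖} := by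
  intro x hx y hy h
  simp only [mem_ofPred_eq] at hx hy
  have hx0 : x ≠ 0 := norm_pos_iff.1 (by linarith)
  have hy0 : y ≠ 0 := norm_pos_iff.1 (by linarith)
  have h1 := joukMap_sub (a := a) hx0 hy0
  rw [h, sub_self, eq_comm, div_eq_zero_iff] at h1
  rcases h1 with h1 | h1
  · rcases mul_eq_zero.1 h1 with h2 | h2
    · exact sub_eq_zero.1 h2
    · have := congrArg norm (sub_eq_zero.1 h2)
      rw [norm_mul, norm_one] at this
      nlinarith
  · exact absurd h1 (mul_ne_zero hx0 hy0)

theorem exists_joukMap_eq (a x : ℂ) : ∃ y : ℂ, 1 ≤ ‖y‖ ∧ joukMap a y = x := by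
  obtain ⟨y, hy⟩ : ∃ y : ℂ, y ^ 2 - (x - a) * y + 1 = 0 := by
    obtain ⟨s, hs⟩ := IsAlgClosed.exists_pow_nat_eq ((x - a) ^ 2 - 4) (n := 2) (by norm_num)
    exact ⟨((x - a) + s) / 2, by linear_combination hs / 4⟩
  have hy0 : y ≠ 0 := by rintro rfl; simp at hy
  have hjy : joukMap a y = x := by
    simp only [joukMap]
    field_simp
    linear_combination hy
  rcases le_total 1 ‖y‖ with h | h
  · exact ⟨y, h, hjy⟩
  · refine ⟨y⁻¹, ?_, ?_⟩
    · rw [norm_inv]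
      exact one_le_inv₀ (norm_pos_iff.2 hy0) |>.2 h
    · rw [← hjy]; simp [joukMap, add_comm]

/-- The annulus `1 < ‖y‖ < R`. -/
def outerAnnulus (R : ℝ) : Set ℂ := {y | 1 < ‖y‖ ∧ ‖y‖ < R}

theorem isOpen_outerAnnulus (R : ℝ) : IsOpen (outerAnnulus R) :=
  (isOpen_lt continuous_const continuous_norm).inter (isOpen_lt continuous_norm continuous_const)

theorem ne_zero_of_mem_outerAnnulus {R : ℝ} {y : ℂ} (hy : y ∈ outerAnnulus R) : y ≠ 0 :=
  norm_pos_iff.1 (zero_lt_one.trans hy.1)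

theorem setLIntegral_ball_le_outerAnnulus (a : ℂ) (F : ℂ → ℝ≥0∞) (R : ℝ) :
    ∫⁻ x in ball 0 (R - (‖a‖ + 1)), F x ≤
      ∫⁻ y in outerAnnulus R, ‖1 - (y ^ 2)⁻¹‖ₑ ^ 2 * F (joukMap a y) := by
  have hnull : volume (joukMap a '' sphere 0 1) = 0 := by
    refine addHaar_image_eq_zero_of_differentiableOn_of_addHaar_eq_zero volume ?_
      (Measure.addHaar_sphere volume 0 1)
    intro y hy
    have hy0 : y ≠ 0 := by rintro rfl; simp at hy
    exact ((hasDerivAt_joukMap a hy0).differentiableAt.restrictScalars ℝ).differentiableWithinAt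
  have hsub : ball (0 : ℂ) (R - (‖a‖ + 1)) ⊆
      joukMap a '' outerAnnulus R ∪ joukMap a '' sphere 0 1 := by
    intro x hx
    obtain ⟨y, hy, rfl⟩ := exists_joukMap_eq a x
    rcases hy.eq_or_lt with h | h
    · exact Or.inr ⟨y, by simp [← h], rfl⟩
    · refine Or.inl ⟨y, ⟨h, ?_⟩, rfl⟩
      rw [mem_ball_zero_iff] at hx
      have h1 : ‖y‖ ≤ ‖joukMap a y‖ + ‖y⁻¹‖ + ‖a‖ := by
        calc ‖y‖ = ‖joukMap a y - y⁻¹ - a‖ := by simp only [joukMap]; ring_nf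
          _ ≤ _ := (norm_sub_le _ _).trans (by gcongr; exact norm_sub_le _ _)
      have h2 : ‖y⁻¹‖ ≤ 1 := by rw [norm_inv]; exact inv_le_one_of_one_le₀ h.le
      linarith
  calc ∫⁻ x in ball 0 (R - (‖a‖ + 1)), F x
      ≤ ∫⁻ x in joukMap a '' outerAnnulus R ∪ joukMap a '' sphere 0 1, F x :=
        lintegral_mono_set hsub
    _ ≤ (∫⁻ x in joukMap a '' outerAnnulus R, F x) + ∫⁻ x in joukMap a '' sphere 0 1, F x :=
        lintegral_union_le _ _ _
    _ = ∫⁻ x in joukMap a '' outerAnnulus R, F x := by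
        rw [setLIntegral_measure_zero _ _ hnull, add_zero]
    _ = _ := lintegral_image_eq_lintegral_enorm_deriv_sq_mul
        (isOpen_outerAnnulus R).measurableSet
        (fun y hy => hasDerivAt_joukMap a (ne_zero_of_mem_outerAnnulus hy))
        ((injOn_joukMap a).mono fun y hy => hy.1) F

theorem setLIntegral_outerAnnulus_le_ball {ψ : ℂ → ℂ} (hψ : Measurable ψ) {R : ℝ} (hR : 1 ≤ R) :
    ∫⁻ y in outerAnnulus R, (‖ψ y‖ₑ + ‖ψ y⁻¹ / y ^ 4‖ₑ) ≤ ∫⁻ z in ball 0 R, ‖ψ z‖ₑ := by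
  have hinv : ∫⁻ y in outerAnnulus R, ‖ψ y⁻¹ / y ^ 4‖ₑ =
      ∫⁻ z in Inv.inv '' outerAnnulus R, ‖ψ z‖ₑ := by
    rw [lintegral_image_eq_lintegral_enorm_deriv_sq_mul (isOpen_outerAnnulus R).measurableSet
      (fun y hy => hasDerivAt_inv (ne_zero_of_mem_outerAnnulus hy)) inv_injective.injOn]
    refine lintegral_congr fun y => ?_
    rw [← enorm_pow, ← enorm_mul]
    congr 1
    rw [neg_sq, ← inv_pow]
    ring
  have hdisj : Disjoint (outerAnnulus R) (Inv.inv '' outerAnnulus R) := by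
    rw [Set.disjoint_left]
    rintro _ h1 ⟨y, hy, rfl⟩
    have := h1.1
    rw [norm_inv] at this
    exact absurd this (inv_lt_one_of_one_lt₀ hy.1).not_gt
  have hmeas : MeasurableSet (Inv.inv '' outerAnnulus R) := by
    rw [image_inv_eq_inv]
    exact (isOpen_outerAnnulus R).measurableSet.inv
  rw [lintegral_add_left hψ.enorm, hinv, ← lintegral_union hmeas hdisj]
  refine lintegral_mono_set ?_
  rintro z (h | ⟨y, hy, rfl⟩)
  · exact mem_ball_zero_iff.2 h.2
  · rw [mem_ball_zero_iff, norm_inv]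
    exact (inv_lt_one_of_one_lt₀ hy.1).trans_le hR

theorem tendsto_setLIntegral_shell {ψ : ℂ → ℂ} {M ρ C : ℝ} (hC : 0 ≤ C)
    (hdecay : ∀ z, ρ ≤ ‖z‖ → ‖ψ z‖ ≤ M / ‖z‖ ^ 2) :
    Tendsto (fun R : ℝ => ∫⁻ z in ball 0 R \ ball 0 (R - C), ‖ψ z‖ₑ) atTop (𝓝 0) := by
  have hlim : Tendsto (fun R : ℝ => ENNReal.ofReal (|M| / (R - C) ^ 2 *
      (Real.pi * (2 * C * (R - C) + C ^ 2)))) atTop (𝓝 0) := by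
    rw [← ENNReal.ofReal_zero]
    refine ENNReal.tendsto_ofReal ?_
    have h0 : Tendsto (fun R : ℝ => (R - C)⁻¹) atTop (𝓝 0) :=
      tendsto_inv_atTop_zero.comp (tendsto_atTop_add_const_right _ (-C) tendsto_id)
    have h1 : Tendsto (fun R : ℝ => |M| * Real.pi * (2 * C * (R - C)⁻¹ + C ^ 2 * (R - C)⁻¹ ^ 2))
        atTop (𝓝 0) := by
      simpa using (((h0.const_mul (2 * C)).add ((h0.pow 2).const_mul (C ^ 2))).const_mul
        (|M| * Real.pi))
    refine h1.congr' ?_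
    filter_upwards [eventually_gt_atTop C] with R hR
    have : R - C ≠ 0 := (sub_pos.2 hR).ne'
    field_simp
  refine tendsto_of_tendsto_of_tendsto_of_le_of_le' tendsto_const_nhds hlim
    (Eventually.of_forall fun _ => zero_le) ?_
  filter_upwards [eventually_gt_atTop (C + |ρ|)] with R hR
  have hRC : 0 < R - C := by linarith [abs_nonneg ρ]
  have hvol : volume (ball (0 : ℂ) R \ ball 0 (R - C)) =
      ENNReal.ofReal (Real.pi * (2 * C * (R - C) + C ^ 2)) := by
    rw [measure_sdiff (ball_subset_ball (by linarith)) measurableSet_ball.nullMeasurableSet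
      measure_ball_lt_top.ne, Complex.volume_ball, Complex.volume_ball]
    rw [← ENNReal.ofReal_coe_nnreal, NNReal.coe_real_pi, ← ENNReal.ofReal_pow (by linarith),
      ← ENNReal.ofReal_pow hRC.le, ← ENNReal.ofReal_mul (by positivity),
      ← ENNReal.ofReal_mul (by positivity), ← ENNReal.ofReal_sub _ (by positivity)]
    congr 1
    ring
  calc ∫⁻ z in ball 0 R \ ball 0 (R - C), ‖ψ z‖ₑ
      ≤ ∫⁻ _ in ball (0 : ℂ) R \ ball 0 (R - C), ENNReal.ofReal (|M| / (R - C) ^ 2) := by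
        refine setLIntegral_mono' (measurableSet_ball.diff measurableSet_ball) fun z hz => ?_
        have hz' : R - C ≤ ‖z‖ := by
          have := hz.2
          rwa [mem_ball_zero_iff, not_lt] at this
        rw [← ofReal_norm]
        refine ENNReal.ofReal_le_ofReal ((hdecay z ?_).trans ?_)
        · linarith [le_abs_self ρ]
        · gcongr
          exact le_abs_self M
    _ = _ := by
        rw [setLIntegral_const, hvol, ← ENNReal.ofReal_mul (by positivity)]

/-- A quadratic differential `ψ dz²` invariant under push-forward by `joukMap a` has no
cancellation between the contributions of the two inverse branches. -/
theorem norm_add_eq_of_invariant {ψ : ℂ → ℂ} {a : ℂ} (hψ : Measurable ψ)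
    (hfin : ∀ R, ∫⁻ z in ball 0 R, ‖ψ z‖ₑ ≠ ∞) {M ρ : ℝ}
    (hdecay : ∀ z, ρ ≤ ‖z‖ → ‖ψ z‖ ≤ M / ‖z‖ ^ 2)
    (hinv : ∀ᵐ y, ψ (joukMap a y) * (1 - (y ^ 2)⁻¹) ^ 2 = ψ y + ψ y⁻¹ / y ^ 4)
    {y₀ : ℂ} (hy₀ : 1 < ‖y₀‖) (hc : ContinuousAt ψ y₀) (hc' : ContinuousAt ψ y₀⁻¹) :
    ‖ψ y₀ + ψ y₀⁻¹ / y₀ ^ 4‖ = ‖ψ y₀‖ + ‖ψ y₀⁻¹ / y₀ ^ 4‖ := by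
  by_contra hne
  have hlt : 0 < ‖ψ y₀‖ + ‖ψ y₀⁻¹ / y₀ ^ 4‖ - ‖ψ y₀ + ψ y₀⁻¹ / y₀ ^ 4‖ :=
    sub_pos.2 (lt_of_le_of_ne (norm_add_le _ _) hne)
  have hy0 : y₀ ≠ 0 := norm_pos_iff.1 (by linarith)
  obtain ⟨η, hη0, hη⟩ := exists_between hlt
  have hg : ContinuousAt (fun y => ψ y⁻¹ / y ^ 4) y₀ :=
    (ContinuousAt.comp (f := Inv.inv) hc' (continuousAt_inv₀ hy0)).div
      (continuousAt_id.pow 4) (pow_ne_zero 4 hy0)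
  have hcont : ContinuousAt
      (fun y => ‖ψ y‖ + ‖ψ y⁻¹ / y ^ 4‖ - ‖ψ y + ψ y⁻¹ / y ^ 4‖) y₀ :=
    (hc.norm.add hg.norm).sub (hc.add hg).norm
  obtain ⟨r, hr, hball⟩ := Metric.eventually_nhds_iff_ball.1 (hcont.eventually (lt_mem_nhds hη))
  set B := ball y₀ r ∩ {y : ℂ | 1 < ‖y‖} with hB
  have hBo : IsOpen B := isOpen_ball.inter (isOpen_lt continuous_const continuous_norm)
  set κ : ℝ≥0∞ := ENNReal.ofReal η * volume B with hκ
  have hκ0 : 0 < κ := ENNReal.mul_pos (by simpa using hη0)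
    (hBo.measure_pos volume ⟨y₀, mem_ball_self hr, hy₀⟩).ne'
  set C := ‖a‖ + 1 with hCdef
  have hC : 0 ≤ C := by positivity
  have key : ∀ R, ‖y₀‖ + r ≤ R → κ ≤ ∫⁻ z in ball 0 R \ ball 0 (R - C), ‖ψ z‖ₑ := by
    intro R hR
    have hBR : B ⊆ outerAnnulus R := fun y hy => ⟨hy.2, by
      have h1 : ‖y - y₀‖ < r := mem_ball_iff_norm.1 hy.1
      have h2 := norm_sub_norm_le y y₀
      linarith⟩
    have h1 : (∫⁻ z in ball 0 (R - C), ‖ψ z‖ₑ) + κ ≤ ∫⁻ z in ball 0 R, ‖ψ z‖ₑ := by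
      calc (∫⁻ z in ball 0 (R - C), ‖ψ z‖ₑ) + κ
          ≤ (∫⁻ y in outerAnnulus R, ‖1 - (y ^ 2)⁻¹‖ₑ ^ 2 * ‖ψ (joukMap a y)‖ₑ) + κ := by
            exact add_le_add (setLIntegral_ball_le_outerAnnulus a (fun z => ‖ψ z‖ₑ) R) le_rfl
        _ = (∫⁻ y in outerAnnulus R, ‖ψ y + ψ y⁻¹ / y ^ 4‖ₑ) +
              ∫⁻ y in outerAnnulus R, B.indicator (fun _ => ENNReal.ofReal η) y := by
            congr 1
            · refine lintegral_congr_ae (ae_restrict_of_ae ?_)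
              filter_upwards [hinv] with y hy
              rw [← hy, enorm_mul, enorm_pow, mul_comm]
            · rw [setLIntegral_indicator hBo.measurableSet, inter_eq_self_of_subset_left hBR,
                setLIntegral_const]
        _ = ∫⁻ y in outerAnnulus R, (‖ψ y + ψ y⁻¹ / y ^ 4‖ₑ +
              B.indicator (fun _ => ENNReal.ofReal η) y) :=
            (lintegral_add_right _ (measurable_const.indicator hBo.measurableSet)).symm
        _ ≤ ∫⁻ y in outerAnnulus R, (‖ψ y‖ₑ + ‖ψ y⁻¹ / y ^ 4‖ₑ) := by
            refine lintegral_mono fun y => ?_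
            by_cases hy : y ∈ B
            · have h2 := hball y hy.1
              simp only [indicator_of_mem hy, ← ofReal_norm]
              rw [← ENNReal.ofReal_add (norm_nonneg _) hη0.le,
                ← ENNReal.ofReal_add (norm_nonneg _) (norm_nonneg _)]
              exact ENNReal.ofReal_le_ofReal (by linarith)
            · simp only [indicator_of_notMem hy, add_zero]
              exact enorm_add_le _ _
        _ ≤ _ := setLIntegral_outerAnnulus_le_ball hψ (by linarith)
    have h2 : ∫⁻ z in ball 0 R, ‖ψ z‖ₑ = (∫⁻ z in ball 0 (R - C), ‖ψ z‖ₑ) +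
        ∫⁻ z in ball 0 R \ ball 0 (R - C), ‖ψ z‖ₑ := by
      rw [← lintegral_union (measurableSet_ball.diff measurableSet_ball) disjoint_sdiff_right,
        union_sdiff_cancel (ball_subset_ball (by linarith))]
    rw [h2] at h1
    exact (ENNReal.add_le_add_iff_left (hfin _)).1 h1
  have hlim := tendsto_setLIntegral_shell hC hdecay
  have h3 : κ ≤ 0 := ge_of_tendsto hlim (eventually_atTop.2 ⟨_, key⟩)
  exact absurd h3 hκ0.not_ge

/-- The rational function with at most simple poles, of residue `α j` at `c j` for `j < m`. -/
def poleSum (c α : ℕ → ℂ) (m : ℕ) (z : ℂ) : ℂ := ∑ j ∈ Finset.range m, α j / (z - c j)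

theorem measurable_poleSum (c α : ℕ → ℂ) (m : ℕ) : Measurable (poleSum c α m) := by
  unfold poleSum
  fun_prop

theorem continuousAt_poleSum {c α : ℕ → ℂ} {m : ℕ} {z : ℂ} (hz : ∀ j < m, z ≠ c j) :
    ContinuousAt (poleSum c α m) z := by
  unfold poleSum
  refine tendsto_finsetSum _ fun j hj => ?_
  exact (continuousAt_const.div (continuousAt_id.sub continuousAt_const)
    (sub_ne_zero.2 (hz j (Finset.mem_range.1 hj)))).tendsto

theorem exists_norm_poleSum_le {c α : ℕ → ℂ} {m : ℕ} (hα : ∑ j ∈ Finset.range m, α j = 0) :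
    ∃ M ρ : ℝ, ∀ z, ρ ≤ ‖z‖ → ‖poleSum c α m z‖ ≤ M / ‖z‖ ^ 2 := by
  refine ⟨∑ j ∈ Finset.range m, 2 * ‖α j * c j‖, 1 + ∑ j ∈ Finset.range m, 2 * ‖c j‖,
    fun z hz => ?_⟩
  have hcj : ∀ j ∈ Finset.range m, 1 + 2 * ‖c j‖ ≤ ‖z‖ := fun j hj => by
    have := Finset.single_le_sum (f := fun j => 2 * ‖c j‖) (fun i _ => by positivity) hj
    linarith
  have hz1 : 1 ≤ ‖z‖ := by
    have : 0 ≤ ∑ j ∈ Finset.range m, 2 * ‖c j‖ := Finset.sum_nonneg fun j _ => by positivity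
    linarith
  have hz0 : z ≠ 0 := norm_pos_iff.1 (by linarith)
  have heq : poleSum c α m z = ∑ j ∈ Finset.range m, α j * c j / (z * (z - c j)) := by
    rw [poleSum, ← sub_zero (∑ j ∈ Finset.range m, α j / (z - c j)), ← zero_div z, ← hα,
      Finset.sum_div, ← Finset.sum_sub_distrib]
    refine Finset.sum_congr rfl fun j hj => ?_
    have h1 : z - c j ≠ 0 := sub_ne_zero.2 fun h => by
      have := hcj j hj
      rw [h] at this
      linarith [norm_nonneg (c j)]
    field_simp
    ring
  rw [heq, Finset.sum_div]
  refine norm_sum_le_of_le _ fun j hj => ?_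
  have h2 : ‖z‖ / 2 ≤ ‖z - c j‖ := by
    linarith [hcj j hj, norm_sub_norm_le z (c j), norm_nonneg (c j)]
  rw [norm_div, norm_mul z, div_le_div_iff₀ (mul_pos (by linarith) (by linarith)) (by positivity)]
  nlinarith [mul_le_mul_of_nonneg_left h2 (mul_nonneg (norm_nonneg (α j * c j)) (norm_nonneg z))]

theorem setLIntegral_ball_enorm_inv_ne_top (R : ℝ) : ∫⁻ z in ball (0 : ℂ) R, ‖z⁻¹‖ₑ ≠ ∞ := by
  rw [← lintegral_indicator measurableSet_ball, ← Complex.lintegral_comp_polarCoord_symm]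
  refine ne_top_of_le_ne_top (b := volume (Ioo (0 : ℝ) R ×ˢ Ioo (-Real.pi) Real.pi)) ?_ ?_
  · rw [Measure.volume_eq_prod, Measure.prod_prod, Real.volume_Ioo, Real.volume_Ioo]
    exact ENNReal.mul_ne_top ENNReal.ofReal_ne_top ENNReal.ofReal_ne_top
  · rw [← lintegral_indicator_one (measurableSet_Ioo.prod measurableSet_Ioo),
      ← lintegral_indicator polarCoord.open_target.measurableSet]
    refine lintegral_mono fun p => ?_
    by_cases hp : p ∈ polarCoord.target
    · rw [indicator_of_mem hp]
      rw [polarCoord_target] at hp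
      have hp0 : 0 < p.1 := hp.1
      have hn : ‖Complex.polarCoord.symm p‖ = p.1 := by
        rw [Complex.norm_polarCoord_symm, abs_of_pos hp0]
      by_cases hb : Complex.polarCoord.symm p ∈ ball (0 : ℂ) R
      · have hmem : p ∈ Ioo (0 : ℝ) R ×ˢ Ioo (-Real.pi) Real.pi :=
          ⟨⟨hp0, by rwa [mem_ball_zero_iff, hn] at hb⟩, hp.2⟩
        rw [indicator_of_mem hb, indicator_of_mem hmem, smul_eq_mul, ← ofReal_norm, norm_inv, hn,
          ← ENNReal.ofReal_mul hp0.le, mul_inv_cancel₀ hp0.ne']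
        simp
      · rw [indicator_of_notMem hb]
        simp
    · rw [indicator_of_notMem hp]
      exact zero_le

theorem setLIntegral_ball_enorm_poleSum_ne_top (c α : ℕ → ℂ) (m : ℕ) (R : ℝ) :
    ∫⁻ z in ball 0 R, ‖poleSum c α m z‖ₑ ≠ ∞ := by
  have hterm : ∀ j, ∫⁻ z in ball 0 R, ‖α j / (z - c j)‖ₑ ≠ ∞ := fun j => by
    have h1 : ∫⁻ z in ball 0 R, ‖(z - c j)⁻¹‖ₑ ≤ ∫⁻ z in ball (0 : ℂ) (R + ‖c j‖), ‖z⁻¹‖ₑ := by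
      rw [← lintegral_indicator measurableSet_ball, ← lintegral_indicator measurableSet_ball,
        ← lintegral_sub_right_eq_self
          ((ball (0 : ℂ) (R + ‖c j‖)).indicator fun z => ‖z⁻¹‖ₑ) (c j)]
      refine lintegral_mono fun z => ?_
      by_cases hz : z ∈ ball (0 : ℂ) R
      · have hz' : z - c j ∈ ball (0 : ℂ) (R + ‖c j‖) := by
          rw [mem_ball_zero_iff] at hz ⊢
          linarith [norm_sub_le z (c j)]
        rw [indicator_of_mem hz, indicator_of_mem hz']
      · rw [indicator_of_notMem hz]
        exact zero_le
    simp_rw [div_eq_mul_inv, enorm_mul]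
    rw [lintegral_const_mul _ (by fun_prop)]
    exact ENNReal.mul_ne_top enorm_ne_top
      (ne_top_of_le_ne_top (setLIntegral_ball_enorm_inv_ne_top _) h1)
  refine ne_top_of_le_ne_top (b := ∑ j ∈ Finset.range m, ∫⁻ z in ball 0 R, ‖α j / (z - c j)‖ₑ)
    (ENNReal.sum_ne_top.2 fun j _ => hterm j) ?_
  rw [← lintegral_finsetSum _ fun j _ => by fun_prop]
  exact lintegral_mono fun z => enorm_sum_le _ _

theorem poleSum_ne_zero_cofinite {c α : ℕ → ℂ} {m : ℕ} (hα : α 0 ≠ 0)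
    (hc : ∀ j, 1 ≤ j → j ≤ m → c j ≠ c 0) :
    ∀ᶠ z in cofinite, poleSum c α (m + 1) z ≠ 0 := by
  set N : Polynomial ℂ := ∑ j ∈ Finset.range (m + 1),
    Polynomial.C (α j) * ∏ i ∈ (Finset.range (m + 1)).erase j, (Polynomial.X - Polynomial.C (c i))
    with hN
  have hN0 : N ≠ 0 := by
    intro h
    have h1 := congrArg (Polynomial.eval (c 0)) h
    rw [hN, Polynomial.eval_finsetSum, Finset.sum_eq_single 0] at h1
    · simp only [Polynomial.eval_mul, Polynomial.eval_C, Polynomial.eval_prod,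
        Polynomial.eval_sub, Polynomial.eval_X, Polynomial.eval_zero, mul_eq_zero, hα, false_or,
        Finset.prod_eq_zero_iff, Finset.mem_erase, Finset.mem_range, sub_eq_zero] at h1
      obtain ⟨i, ⟨hi0, him⟩, hi⟩ := h1
      exact hc i (by omega) (by omega) hi.symm
    · intro j _ hj
      rw [Polynomial.eval_mul, Polynomial.eval_prod, Finset.prod_eq_zero (i := 0), mul_zero]
      · simp [hj.symm]
      · simp
    · simp
  have hroots : ∀ᶠ z in cofinite, ¬ N.IsRoot z :=
    (Polynomial.finite_setOfPred_isRoot hN0).subset fun z hz => not_not.1 hz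
  have hpoles : ∀ᶠ z in cofinite, ∀ j ∈ Finset.range (m + 1), z ≠ c j :=
    (Finset.eventually_all _).2 fun j _ => eventually_cofinite_ne _
  filter_upwards [hroots, hpoles] with z hz hp h0
  refine hz ?_
  have : N.eval z = poleSum c α (m + 1) z * ∏ i ∈ Finset.range (m + 1), (z - c i) := by
    rw [hN, poleSum, Polynomial.eval_finsetSum, Finset.sum_mul]
    refine Finset.sum_congr rfl fun j hj => ?_
    rw [← Finset.mul_prod_erase _ _ hj, ← mul_assoc, div_mul_cancel₀ _ (sub_ne_zero.2 (hp j hj))]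
    simp [Polynomial.eval_prod]
  rw [Polynomial.IsRoot, this, h0, zero_mul]

theorem joukMap_sub_critVal {a σ y : ℂ} (hσ : σ ^ 2 = 1) (hy : y ≠ 0) :
    joukMap a y - (a + 2 * σ) = (y - σ) ^ 2 / y := by
  simp only [joukMap]
  field_simp
  linear_combination -hσ

/-- Push-forward of `dz² / (z - c)` under `joukMap a`, for `c` neither a pole nor critical. -/
theorem pushforward_simple_pole {a c y : ℂ} (hc : c ≠ 0) (hc1 : c ^ 2 ≠ 1) (hy : y ≠ 0)
    (hy1 : y ^ 2 ≠ 1) (hyc : y ≠ c) (hyc' : y * c ≠ 1) :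
    1 / (y - c) + 1 / (y⁻¹ - c) / y ^ 4 = (1 - (y ^ 2)⁻¹) ^ 2 *
      (c ^ 2 / (c ^ 2 - 1) / (joukMap a y - joukMap a c) +
        1 / (2 * (1 - c)) / (joukMap a y - (a + 2)) +
        1 / (2 * (1 + c)) / (joukMap a y - (a - 2))) := by
  have h1 := joukMap_sub_critVal (a := a) (one_pow 2) hy
  have h2 := joukMap_sub_critVal (a := a) (σ := -1) (by norm_num) hy
  rw [mul_one] at h1
  rw [show a + 2 * -1 = a - 2 by ring, sub_neg_eq_add] at h2
  rw [joukMap_sub hy hc, h1, h2]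
  have e1 : y - 1 ≠ 0 := fun h => hy1 (by linear_combination (y + 1) * h)
  have e2 : y + 1 ≠ 0 := fun h => hy1 (by linear_combination (y - 1) * h)
  have e3 : 1 - c ≠ 0 := fun h => hc1 (by linear_combination -(c + 1) * h)
  have e4 : 1 + c ≠ 0 := fun h => hc1 (by linear_combination (c - 1) * h)
  have e5 : c ^ 2 - 1 ≠ 0 := sub_ne_zero.2 hc1
  have e6 : y - c ≠ 0 := sub_ne_zero.2 hyc
  have e7 : y * c - 1 ≠ 0 := sub_ne_zero.2 hyc'
  have e8 : y⁻¹ - c = -(y * c - 1) / y := by field_simp; ring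
  have e9 : c ^ 2 - 1 = -((1 - c) * (1 + c)) := by ring
  rw [e8, e9]
  field_simp
  ring

/-- Push-forward of `dz² / (z - c)` under `joukMap a`, for `c` the pole or the critical point
`1`. -/
theorem exists_pushforward_terminal_pole {a c : ℂ} (hc : c = 0 ∨ c = 1) :
    ∃ P Q : ℂ, P + Q = 1 ∧ P * (a + 2) + Q * (a - 2) = c + a ∧
      ∀ y, y ≠ 0 → y ^ 2 ≠ 1 →
        1 / (y - c) + 1 / (y⁻¹ - c) / y ^ 4 = (1 - (y ^ 2)⁻¹) ^ 2 *
          (P / (joukMap a y - (a + 2)) + Q / (joukMap a y - (a - 2))) := by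
  have key : ∀ y : ℂ, y ≠ 0 → y ^ 2 ≠ 1 → y - 1 ≠ 0 ∧ y + 1 ≠ 0 ∧
      joukMap a y - (a + 2) = (y - 1) ^ 2 / y ∧ joukMap a y - (a - 2) = (y + 1) ^ 2 / y := by
    intro y hy hy1
    have h1 := joukMap_sub_critVal (a := a) (one_pow 2) hy
    have h2 := joukMap_sub_critVal (a := a) (σ := -1) (by norm_num) hy
    rw [mul_one] at h1
    rw [show a + 2 * -1 = a - 2 by ring, sub_neg_eq_add] at h2
    exact ⟨fun h => hy1 (by linear_combination (y + 1) * h),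
      fun h => hy1 (by linear_combination (y - 1) * h), h1, h2⟩
  rcases hc with rfl | rfl
  · refine ⟨1 / 2, 1 / 2, by norm_num, by ring, fun y hy hy1 => ?_⟩
    obtain ⟨e1, e2, h1, h2⟩ := key y hy hy1
    rw [h1, h2, sub_zero, sub_zero]
    field_simp
    ring
  · refine ⟨3 / 4, 1 / 4, by norm_num, by ring, fun y hy hy1 => ?_⟩
    obtain ⟨e1, e2, h1, h2⟩ := key y hy hy1
    have e3 : y⁻¹ - 1 = -(y - 1) / y := by field_simp; ring
    rw [h1, h2, e3]
    field_simp
    ring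

/-- The quadratic differential with residues `α` along a finite critical orbit `c` is invariant
under push-forward, provided the residues sum to zero. -/
theorem poleSum_invariant {a σ : ℂ} {m : ℕ} {c α : ℕ → ℂ} (hσ : σ = 1 ∨ σ = -1)
    (hc0 : c 0 = a + 2 * σ) (hcs : ∀ j < m, c (j + 1) = joukMap a (c j))
    (hcne : ∀ j < m, c j ≠ 0 ∧ c j ^ 2 ≠ 1) (hcm : c m = 0 ∨ c m = 1)
    (hαs : ∀ j < m, α (j + 1) = α j * (c j ^ 2 / (c j ^ 2 - 1)))
    (hα : ∑ j ∈ Finset.range (m + 1), α j = 0)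
    {y : ℂ} (hy : y ≠ 0) (hy1 : y ^ 2 ≠ 1) (hyc : ∀ j < m, y ≠ c j ∧ y * c j ≠ 1) :
    poleSum c α (m + 1) (joukMap a y) * (1 - (y ^ 2)⁻¹) ^ 2 =
      poleSum c α (m + 1) y + poleSum c α (m + 1) y⁻¹ / y ^ 4 := by
  have ind : ∀ k ≤ m, ∃ P Q : ℂ,
      P + Q + ∑ j ∈ Finset.range k, α (j + 1) = ∑ j ∈ Finset.range k, α j ∧
      P * (a + 2) + Q * (a - 2) + ∑ j ∈ Finset.range k, α (j + 1) * c (j + 1) =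
        ∑ j ∈ Finset.range k, α j * (c j + a) ∧
      poleSum c α k y + poleSum c α k y⁻¹ / y ^ 4 = (1 - (y ^ 2)⁻¹) ^ 2 *
        (∑ j ∈ Finset.range k, α (j + 1) / (joukMap a y - c (j + 1)) +
          P / (joukMap a y - (a + 2)) + Q / (joukMap a y - (a - 2))) := by
    intro k
    induction k with
    | zero => exact fun _ => ⟨0, 0, by simp, by simp, by simp [poleSum]⟩
    | succ k ih =>
      intro hk
      obtain ⟨P, Q, h1, h2, h3⟩ := ih (by omega)
      obtain ⟨hne, hne1⟩ := hcne k (by omega)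
      have hp := pushforward_simple_pole (a := a) hne hne1 hy hy1 (hyc k (by omega)).1
        (hyc k (by omega)).2
      have e3 : 1 - c k ≠ 0 := fun h => hne1 (by linear_combination -(c k + 1) * h)
      have e4 : 1 + c k ≠ 0 := fun h => hne1 (by linear_combination (c k - 1) * h)
      have e9 : c k ^ 2 - 1 = -((1 - c k) * (1 + c k)) := by ring
      refine ⟨P + α k * (1 / (2 * (1 - c k))), Q + α k * (1 / (2 * (1 + c k))), ?_, ?_, ?_⟩
      · rw [Finset.sum_range_succ, Finset.sum_range_succ, ← h1, hαs k (by omega), e9]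
        field_simp
        ring
      · rw [Finset.sum_range_succ, Finset.sum_range_succ, ← h2, hαs k (by omega),
          hcs k (by omega), e9, joukMap]
        field_simp
        ring
      · simp only [poleSum] at h3 ⊢
        rw [Finset.sum_range_succ, Finset.sum_range_succ, Finset.sum_range_succ,
          hαs k (by omega), hcs k (by omega)]
        linear_combination h3 + α k * hp
  obtain ⟨P, Q, h1, h2, h3⟩ := ind m le_rfl
  obtain ⟨P', Q', h1', h2', h3'⟩ := exists_pushforward_terminal_pole (a := a) hcm
  have hp := h3' y hy hy1
  have hsum : ∑ j ∈ Finset.range m, α j + α m = ∑ j ∈ Finset.range m, α (j + 1) + α 0 := by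
    rw [← Finset.sum_range_succ, Finset.sum_range_succ']
  have hsum0 : ∑ j ∈ Finset.range m, α j + α m = 0 := by rw [← Finset.sum_range_succ, hα]
  have hmom : ∑ j ∈ Finset.range m, α j * c j + α m * c m =
      ∑ j ∈ Finset.range m, α (j + 1) * c (j + 1) + α 0 * c 0 := by
    rw [← Finset.sum_range_succ (fun j => α j * c j), Finset.sum_range_succ']
  simp only [mul_add, Finset.sum_add_distrib, ← Finset.sum_mul] at h2
  have hS : (P + α m * P') + (Q + α m * Q') = α 0 := by
    linear_combination h1 + α m * h1' + hsum
  have hM : (P + α m * P') * (a + 2) + (Q + α m * Q') * (a - 2) = α 0 * c 0 := by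
    linear_combination h2 + α m * h2' + hmom + a * hsum0
  have hfin : poleSum c α (m + 1) (joukMap a y) =
      ∑ j ∈ Finset.range m, α (j + 1) / (joukMap a y - c (j + 1)) +
        (P + α m * P') / (joukMap a y - (a + 2)) + (Q + α m * Q') / (joukMap a y - (a - 2)) := by
    rw [poleSum, Finset.sum_range_succ', add_assoc]
    congr 1
    rcases hσ with rfl | rfl
    · have hQ : Q + α m * Q' = 0 := by
        rw [hc0] at hM
        linear_combination (a + 2) / 4 * hS - hM / 4
      have hP : P + α m * P' = α 0 := by linear_combination hS - hQ
      rw [hP, hQ, hc0]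
      simp
    · have hP : P + α m * P' = 0 := by
        rw [hc0] at hM
        linear_combination hM / 4 - (a - 2) / 4 * hS
      have hQ : Q + α m * Q' = α 0 := by linear_combination hS - hP
      rw [hP, hQ, hc0, show a + 2 * -1 = a - 2 by ring]
      simp
  rw [hfin]
  simp only [poleSum] at h3 ⊢
  rw [Finset.sum_range_succ, Finset.sum_range_succ]
  linear_combination -h3 - α m * hp

/-- A meromorphic function tending to `0` takes values off `[0, ∞)` near its zero. -/
theorem MeromorphicAt.frequently_norm_one_add_ne {h : ℂ → ℂ} (hm : MeromorphicAt h 0)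
    (h0 : ∀ᶠ x in 𝓝[≠] 0, h x ≠ 0) (hlim : Tendsto h (𝓝[≠] 0) (𝓝 0)) :
    ∃ᶠ x in 𝓝[≠] 0, ‖1 + h x‖ ≠ 1 + ‖h x‖ := by
  intro hev
  simp only [not_not] at hev
  have hpos : 0 < meromorphicOrderAt h 0 := (tendsto_zero_iff_meromorphicOrderAt_pos hm).1 hlim
  have htop := (meromorphicOrderAt_ne_top_iff_eventually_ne_zero hm).2 h0
  obtain ⟨G, hG, hG0, hGe⟩ := (meromorphicOrderAt_ne_top_iff hm).1 htop
  obtain ⟨n, hn⟩ : ∃ n : ℕ, (meromorphicOrderAt h 0).untop₀ = (n : ℤ) :=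
    Int.eq_ofNat_of_zero_le (by
      rw [← WithTop.coe_le_coe, WithTop.coe_untop₀_of_ne_top htop]; exact hpos.le)
  have hn0 : n ≠ 0 := by
    rintro rfl
    rw [← WithTop.coe_untop₀_of_ne_top htop, hn] at hpos
    simp at hpos
  obtain ⟨ω, hω⟩ := IsAlgClosed.exists_pow_nat_eq (-(G 0)⁻¹) (n := n) (Nat.pos_of_ne_zero hn0)
  have hω0 : ω ≠ 0 := by
    rintro rfl
    rw [zero_pow hn0, eq_comm, neg_eq_zero, inv_eq_zero] at hω
    exact hG0 hω
  have hcont : ContinuousAt (fun t : ℝ => (t : ℂ) * ω) 0 := by fun_prop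
  have hray : Tendsto (fun t : ℝ => (t : ℂ) * ω) (𝓝[>] 0) (𝓝[≠] 0) := by
    refine tendsto_nhdsWithin_iff.2 ⟨?_, ?_⟩
    · have := hcont.tendsto
      simp only [Complex.ofReal_zero, zero_mul] at this
      exact this.mono_left nhdsWithin_le_nhds
    · filter_upwards [self_mem_nhdsWithin] with t ht
      exact mul_ne_zero (Complex.ofReal_ne_zero.2 (ne_of_gt ht)) hω0
  have hre : Tendsto (fun t : ℝ => (ω ^ n * G (t * ω)).re) (𝓝[>] 0) (𝓝 (-1)) := by
    have h1 : Tendsto (fun t : ℝ => ω ^ n * G (t * ω)) (𝓝[>] 0) (𝓝 (ω ^ n * G 0)) :=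
      ((hG.continuousAt.tendsto.mono_left nhdsWithin_le_nhds).comp hray).const_mul _
    have hval : ω ^ n * G 0 = -1 := by rw [hω, neg_mul, inv_mul_cancel₀ hG0]
    rw [hval] at h1
    have h2 := (Complex.continuous_re.tendsto _).comp h1
    rwa [Complex.neg_re, Complex.one_re] at h2
  obtain ⟨t, ht1, ht2, ht3, ht4⟩ := ((hre.eventually (gt_mem_nhds (by norm_num : (-1 : ℝ) < 0))).and
    ((hray.eventually hev).and ((hray.eventually hGe).and self_mem_nhdsWithin))).exists
  have ht0 : (0 : ℝ) < t := ht4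
  have hval : h (t * ω) = ((t ^ n : ℝ) : ℂ) * (ω ^ n * G (t * ω)) := by
    rw [ht3]
    simp only [sub_zero]
    rw [hn, zpow_natCast, smul_eq_mul, mul_pow]
    push_cast
    ring
  have hneg : (h (t * ω)).re < 0 := by
    rw [hval, Complex.re_ofReal_mul]
    exact mul_neg_of_pos_of_neg (by positivity) ht1
  have hsq := congrArg (· ^ 2) ht2
  simp only [Complex.sq_norm, Complex.normSq_add, map_one, one_mul, Complex.conj_re, add_sq,
    one_pow, mul_one] at hsq
  linarith [norm_nonneg (h (t * ω))]

/-- No nonzero meromorphic germ at infinity satisfies the invariance relation without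
cancellation. -/
theorem false_of_invariant_of_norm_add_eq {ψ : ℂ → ℂ} {a : ℂ} (hψ0 : MeromorphicAt ψ 0)
    (hψi : MeromorphicAt (fun x => ψ x⁻¹) 0) (hne0 : ∀ᶠ x in 𝓝[≠] 0, ψ x ≠ 0)
    (hnei : ∀ᶠ x in 𝓝[≠] 0, ψ x⁻¹ ≠ 0)
    (hinv : ∀ᶠ x in 𝓝[≠] 0,
      ψ (joukMap a x⁻¹) * (1 - x ^ 2) ^ 2 = ψ x⁻¹ + ψ x * x ^ 4)
    (hnorm : ∀ᶠ x in 𝓝[≠] 0, ‖ψ x⁻¹ + ψ x * x ^ 4‖ = ‖ψ x⁻¹‖ + ‖ψ x * x ^ 4‖) : False := by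
  set h : ℂ → ℂ := fun x => ψ x * x ^ 4 / ψ x⁻¹ with hh
  have hm : MeromorphicAt h 0 := (hψ0.mul ((MeromorphicAt.id 0).pow 4)).div hψi
  have h0 : ∀ᶠ x in 𝓝[≠] 0, h x ≠ 0 := by
    filter_upwards [hne0, hnei, self_mem_nhdsWithin] with x h1 h2 h3
    exact div_ne_zero (mul_ne_zero h1 (pow_ne_zero 4 h3)) h2
  obtain ⟨K, hK, hK0, hKe⟩ := (meromorphicOrderAt_ne_top_iff hψi).1
    ((meromorphicOrderAt_ne_top_iff_eventually_ne_zero hψi).2 hnei)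
  set p := (meromorphicOrderAt (fun x => ψ x⁻¹) 0).untop₀
  simp only [sub_zero, smul_eq_mul] at hKe
  set X : ℂ → ℂ := fun x => x / (1 + a * x + x ^ 2) with hX
  have hden : Tendsto (fun x : ℂ => 1 + a * x + x ^ 2) (𝓝[≠] 0) (𝓝 1) := by
    have : ContinuousAt (fun x : ℂ => 1 + a * x + x ^ 2) 0 := by fun_prop
    simpa using this.tendsto.mono_left nhdsWithin_le_nhds
  have hden0 : ∀ᶠ x : ℂ in 𝓝[≠] 0, 1 + a * x + x ^ 2 ≠ 0 := hden.eventually_ne one_ne_zero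
  have hid : Tendsto (fun x : ℂ => x) (𝓝[≠] 0) (𝓝 0) := nhdsWithin_le_nhds
  have hXlim : Tendsto X (𝓝[≠] 0) (𝓝[≠] 0) := by
    refine tendsto_nhdsWithin_iff.2 ⟨?_, ?_⟩
    · have h1 := hid.div hden one_ne_zero
      rwa [zero_div] at h1
    · filter_upwards [hden0, self_mem_nhdsWithin] with x h1 h2
      exact div_ne_zero h2 h1
  have hK1 : Tendsto K (𝓝[≠] 0) (𝓝 (K 0)) := hK.continuousAt.tendsto.mono_left nhdsWithin_le_nhds
  have hlim : Tendsto (fun x => (1 + a * x + x ^ 2)⁻¹ ^ p * (K (X x) / K x) * (1 - x ^ 2) ^ 2 - 1)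
      (𝓝[≠] 0) (𝓝 0) := by
    have h1 := ((((hden.inv₀ one_ne_zero).zpow₀ p (Or.inl (by simp))).mul
      ((hK1.comp hXlim).div hK1 hK0)).mul (((hid.pow 2).const_sub 1).pow 2)).sub_const 1
    simpa [div_self hK0] using h1
  have hlim' : Tendsto h (𝓝[≠] 0) (𝓝 0) := by
    refine hlim.congr' ?_
    filter_upwards [hinv, hnei, hKe, hXlim.eventually hKe, hden0, self_mem_nhdsWithin,
      hK1.eventually_ne hK0] with x h1 h2 h3 h4 h5 h6 h7
    have hx : x ≠ 0 := h6
    have hj : joukMap a x⁻¹ = (X x)⁻¹ := by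
      simp only [hX, joukMap, inv_inv, inv_div]
      field_simp
      ring
    have hd : h x = ψ (joukMap a x⁻¹) * (1 - x ^ 2) ^ 2 / ψ x⁻¹ - 1 := by
      rw [h1, add_div, div_self h2, add_sub_cancel_left]
    have hXp : X x ^ p = x ^ p * (1 + a * x + x ^ 2)⁻¹ ^ p := by
      rw [← mul_zpow, ← div_eq_mul_inv]
    rw [hd, hj, h4, h3, hXp]
    have := zpow_ne_zero p hx
    field_simp
  refine hm.frequently_norm_one_add_ne h0 hlim' ?_
  filter_upwards [hnorm, hnei] with x h1 h2
  rw [not_not]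
  have h3 : ψ x * x ^ 4 = ψ x⁻¹ * h x := (mul_div_cancel₀ _ h2).symm
  have h4 : ψ x⁻¹ + ψ x * x ^ 4 = ψ x⁻¹ * (1 + h x) := by rw [h3]; ring
  rw [h4, h3, norm_mul, norm_mul] at h1
  exact mul_left_cancel₀ (norm_ne_zero_iff.2 h2) (by rw [h1]; ring)

/-- The residues of the candidate invariant differential along the orbit `c`. -/
def orbitResidue (c : ℕ → ℂ) : ℕ → ℂ
  | 0 => 1
  | n + 1 => orbitResidue c n * (c n ^ 2 / (c n ^ 2 - 1))

/-- There is no nonzero integrable invariant quadratic differential supported on a critical orbit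
of `joukMap a` ending at the pole `0` or at the critical point `1`. -/
theorem sum_orbitResidue_ne_zero {a σ : ℂ} {m : ℕ} {c : ℕ → ℂ} (hσ : σ = 1 ∨ σ = -1)
    (hc0 : c 0 = a + 2 * σ) (hcs : ∀ j < m, c (j + 1) = joukMap a (c j))
    (hcne : ∀ j < m, c j ≠ 0 ∧ c j ^ 2 ≠ 1) (hcm : c m = 0 ∨ c m = 1) :
    ∑ j ∈ Finset.range (m + 1), orbitResidue c j ≠ 0 := by
  intro hα
  have hinj : ∀ j, 1 ≤ j → j ≤ m → c j ≠ c 0 := by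
    intro j hj hjm h
    have hper : ∀ i, i + j ≤ m → c (i + j) = c i := by
      intro i
      induction i with
      | zero => simpa using fun _ => h
      | succ i ih =>
        intro hi
        rw [show i + 1 + j = i + j + 1 by ring, hcs _ (by omega), hcs _ (by omega), ih (by omega)]
    have h1 := hper (m - j) (by omega)
    rw [Nat.sub_add_cancel hjm] at h1
    obtain ⟨h2, h3⟩ := hcne (m - j) (by omega)
    rw [← h1] at h2 h3
    rcases hcm with h4 | h4
    · exact h2 h4
    · exact h3 (by rw [h4, one_pow])
  set ψ := poleSum c (orbitResidue c) (m + 1) with hψ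
  have hnz : ∀ᶠ z in cofinite, ψ z ≠ 0 :=
    poleSum_ne_zero_cofinite (by simp [orbitResidue]) hinj
  have hpoles : ∀ᶠ y in cofinite, ∀ j ∈ Finset.range (m + 1), y ≠ c j :=
    (Finset.eventually_all _).2 fun j _ => eventually_cofinite_ne _
  have hcont : ∀ᶠ y in cofinite, ContinuousAt ψ y := by
    filter_upwards [hpoles] with y hy
    exact continuousAt_poleSum fun j hj => hy j (Finset.mem_range.2 hj)
  have hinv : ∀ᶠ y in cofinite,
      ψ (joukMap a y) * (1 - (y ^ 2)⁻¹) ^ 2 = ψ y + ψ y⁻¹ / y ^ 4 := by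
    have hpoles' : ∀ᶠ y in cofinite, ∀ j ∈ Finset.range (m + 1), y ≠ (c j)⁻¹ :=
      (Finset.eventually_all _).2 fun j _ => eventually_cofinite_ne _
    filter_upwards [hpoles, hpoles', eventually_cofinite_ne 0, eventually_cofinite_ne 1,
      eventually_cofinite_ne (-1)] with y h1 h2 h3 h4 h5
    refine poleSum_invariant hσ hc0 hcs hcne hcm (fun j _ => rfl) hα h3 ?_ fun j hj => ⟨?_, ?_⟩
    · exact fun h => (mul_self_eq_one_iff.1 ((sq y).symm.trans h)).elim h4 h5
    · exact h1 j (Finset.mem_range.2 (by omega))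
    · exact fun h => h2 j (Finset.mem_range.2 (by omega)) (eq_inv_of_mul_eq_one_left h)
  have hnhds : 𝓝[≠] (0 : ℂ) ≤ cofinite := nhdsNE_le_cofinite 0
  have hinf : Tendsto (Inv.inv : ℂ → ℂ) (𝓝[≠] 0) cofinite :=
    tendsto_inv₀_nhdsNE_zero.mono_right (Bornology.le_cofinite ℂ)
  obtain ⟨M, ρ, hdecay⟩ := exists_norm_poleSum_le hα
  have hmero : MeromorphicAt ψ 0 := by
    rw [hψ]
    unfold poleSum
    fun_prop
  have hmeroi : MeromorphicAt (fun x => ψ x⁻¹) 0 := by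
    rw [hψ]
    unfold poleSum
    fun_prop
  refine false_of_invariant_of_norm_add_eq (a := a) hmero hmeroi (hnhds hnz)
    (hinf.eventually hnz) ?_ ?_
  · filter_upwards [hinf.eventually hinv] with x hx
    simpa only [inv_inv, inv_pow, div_inv_eq_mul] using hx
  · have hlarge : ∀ᶠ x : ℂ in 𝓝[≠] 0, 1 < ‖x⁻¹‖ :=
      (tendsto_norm_cobounded_atTop.comp tendsto_inv₀_nhdsNE_zero).eventually_gt_atTop 1
    filter_upwards [hlarge, hinf.eventually hcont, hnhds hcont] with x h1 h2 h3
    have h4 := norm_add_eq_of_invariant (measurable_poleSum c (orbitResidue c) (m + 1))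
      (setLIntegral_ball_enorm_poleSum_ne_top c (orbitResidue c) (m + 1)) hdecay
      (a := a) (ae_iff.2 (Set.Finite.measure_zero (mem_cofinite.1 hinv) _)) h1 h2 (by rwa [inv_inv])
    simpa only [inv_inv, inv_pow, div_inv_eq_mul] using h4

theorem sum_orbitResidue_eq {c d : ℕ → ℂ} {m : ℕ} (hd0 : d 0 = 1)
    (hds : ∀ j < m, d (j + 1) = 1 + (1 - (c j ^ 2)⁻¹) * d j)
    (hcne : ∀ j < m, c j ≠ 0 ∧ c j ^ 2 ≠ 1) :
    ∑ j ∈ Finset.range (m + 1), orbitResidue c j = orbitResidue c m * d m := by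
  induction m with
  | zero => simp [hd0, orbitResidue]
  | succ m ih =>
    obtain ⟨h1, h2⟩ := hcne m (by omega)
    have h3 : c m ^ 2 - 1 ≠ 0 := sub_ne_zero.2 h2
    rw [Finset.sum_range_succ, ih (fun j hj => hds j (by omega)) fun j hj => hcne j (by omega),
      hds m (by omega), orbitResidue]
    field_simp
    ring

/-- Derivative recursion along a critical orbit `u` of `joukMap a` starting at `u 0 = 1`: the
parameter derivative does not vanish when the orbit first hits `0` or `1`. -/
theorem parameter_deriv_ne_zero {a : ℂ} {n : ℕ} (hn : 1 ≤ n) {u D : ℕ → ℂ} (hu0 : u 0 = 1)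
    (hus : ∀ j < n, u (j + 1) = joukMap a (u j))
    (hDs : ∀ j < n, D (j + 1) = 1 + (1 - (u j ^ 2)⁻¹) * D j)
    (hne : ∀ j, 1 ≤ j → j < n → u j ≠ 0 ∧ u j ≠ 1) (hend : u n = 0 ∨ u n = 1) : D n ≠ 0 := by
  set k := Nat.findGreatest (fun j => u j ^ 2 = 1) (n - 1) with hk
  have hk1 : u k ^ 2 = 1 :=
    Nat.findGreatest_spec (P := fun j => u j ^ 2 = 1) (Nat.zero_le _) (by rw [hu0, one_pow])
  have hkn : k ≤ n - 1 := Nat.findGreatest_le _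
  obtain ⟨m, hm⟩ : ∃ m, n = k + 1 + m := ⟨n - 1 - k, by omega⟩
  set c : ℕ → ℂ := fun i => u (k + 1 + i) with hc
  have hσ : u k = 1 ∨ u k = -1 := mul_self_eq_one_iff.1 ((sq _).symm.trans hk1)
  have hcne : ∀ j < m, c j ≠ 0 ∧ c j ^ 2 ≠ 1 := fun j hj =>
    ⟨(hne _ (by omega) (by omega)).1, Nat.findGreatest_is_greatest (P := fun j => u j ^ 2 = 1)
      (n := n - 1) (by omega) (by omega)⟩
  have hsum := sum_orbitResidue_ne_zero (a := a) (c := c) (m := m) hσ ?_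
    (fun j hj => hus (k + 1 + j) (by omega)) hcne (by simpa only [hc, ← hm] using hend)
  · rw [sum_orbitResidue_eq (d := fun i => D (k + 1 + i)) ?_
      (fun j hj => hDs (k + 1 + j) (by omega)) hcne] at hsum
    · rw [hm]
      exact right_ne_zero_of_mul hsum
    · simp [hDs k (by omega), hk1]
  · have hinv : (u k)⁻¹ = u k := inv_eq_of_mul_eq_one_left (by rw [← sq, hk1])
    simp only [hc, add_zero]
    rw [hus k (by omega), joukMap, hinv]
    ring

theorem wfun_add_one_succ {n : ℕ} {v : ℂ} (h : wfun n v + 1 ≠ 0) :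
    wfun (n + 1) v + 1 = joukMap (v - 1) (wfun n v + 1) := by
  simp only [wfun, joukMap]
  field_simp
  ring

theorem analyticAt_wfun {v₀ : ℂ} {n : ℕ} (h : ∀ j < n, wfun j v₀ + 1 ≠ 0) :
    AnalyticAt ℂ (wfun n) v₀ := by
  induction n with
  | zero => exact analyticAt_const
  | succ n ih =>
    have hn := ih fun j hj => h j (by omega)
    exact analyticAt_id.add ((hn.pow 2).div (hn.add analyticAt_const) (h n (by omega)))

theorem deriv_wfun_succ {v₀ : ℂ} {n : ℕ} (h : ∀ j < n + 1, wfun j v₀ + 1 ≠ 0) :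
    deriv (wfun (n + 1)) v₀ = 1 + (1 - ((wfun n v₀ + 1) ^ 2)⁻¹) * deriv (wfun n) v₀ := by
  have hd := (analyticAt_wfun fun j hj => h j (by omega)).differentiableAt.hasDerivAt (x := v₀)
    (f := wfun n)
  have hn := h n (by omega)
  have h1 : HasDerivAt (wfun (n + 1)) _ v₀ :=
    (hasDerivAt_id v₀).add ((hd.pow 2).div (hd.add_const 1) hn)
  rw [h1.deriv]
  simp only [Pi.pow_apply]
  field_simp
  ring

theorem stmt3 (v₀ : ℂ) (ℓ₀ : ℕ) (hℓ₀ : 1 ≤ ℓ₀)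
    (h1 : ∀ ℓ, 1 ≤ ℓ → ℓ < ℓ₀ → wfun ℓ v₀ ≠ 0 ∧ wfun ℓ v₀ ≠ -1)
    (h2 : wfun ℓ₀ v₀ = 0 ∨ wfun ℓ₀ v₀ = -1) :
    (∀ ℓ ≤ ℓ₀, ∃ s : Set ℂ, IsOpen s ∧ v₀ ∈ s ∧ DifferentiableOn ℂ (wfun ℓ) s) ∧
    deriv (wfun ℓ₀) v₀ ≠ 0 := by
  have hne : ∀ j < ℓ₀, wfun j v₀ + 1 ≠ 0 := by
    intro j hj
    rcases Nat.eq_zero_or_pos j with rfl | hj0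
    · simp [wfun]
    · exact fun h => (h1 j hj0 hj).2 (eq_neg_of_add_eq_zero_left h)
  refine ⟨fun ℓ hℓ => ?_, ?_⟩
  · have han := analyticAt_wfun (n := ℓ) fun j hj => hne j (by omega)
    obtain ⟨s, hs, hso, hv⟩ := _root_.eventually_nhds_iff.1 han.eventually_analyticAt
    exact ⟨s, hso, hv, fun v hvs => (hs v hvs).differentiableAt.differentiableWithinAt⟩
  · refine parameter_deriv_ne_zero (a := v₀ - 1) (u := fun j => wfun j v₀ + 1)
      (D := fun j => deriv (wfun j) v₀) hℓ₀ (by simp [wfun])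
      (fun j hj => wfun_add_one_succ (hne j hj))
      (fun j hj => deriv_wfun_succ fun i hi => hne i (by omega))
      (fun j hj0 hj => ⟨hne j hj, fun h => (h1 j hj0 hj).1 (by simpa using h)⟩) ?_
    rcases h2 with h | h
    · exact Or.inr (by simp [h])
    · exact Or.inl (by simp [h])
end
end
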